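/- Let H be smooth, L = ∂² + H, and for a solution w of w''' + 4Hw' + 2H'w = 0 set S(w) = -½w' + w∂ (a first-order operator). Then for two such solutions w₁, w₂, the remainder upon dividing [S(w₁), S(w₂)] by L is S(w₃) where w₃ = w₁w₂' - w₂w₁' (the Wronskian), and w₃ again satisfies the same third-order equation. -/

import Mathlib

/-- The even-symmetry operator `S(w) = -½w' + w∂` of the Schrödinger operator. -/
noncomputable def Sop (w : ℝ → ℝ) (f : ℝ → ℝ) : ℝ → ℝ :=
  fun x => -(1/2) * deriv w x * f x + w x * deriv f x

/-- for solutions `w₁, w₂` of `w''' + 4Hw' + 2H'w = 0`, the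
remainder of `[S(w₁), S(w₂)]` upon division by `L = ∂² + H` is `S(w₃)` with
`w₃ = w₁w₂' - w₂w₁'` (here `[S(w₁),S(w₂)]` has order ≤ 1, so it equals its own
remainder), and `w₃` again solves the same third-order equation. -/
theorem stmt_14 (H w₁ w₂ : ℝ → ℝ)
    (hH : ContDiff ℝ (⊤ : ℕ∞) H) (hw₁ : ContDiff ℝ (⊤ : ℕ∞) w₁) (hw₂ : ContDiff ℝ (⊤ : ℕ∞) w₂)
    (h₁ : ∀ x : ℝ, iteratedDeriv 3 w₁ x + 4 * H x * deriv w₁ x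
        + 2 * deriv H x * w₁ x = 0)
    (h₂ : ∀ x : ℝ, iteratedDeriv 3 w₂ x + 4 * H x * deriv w₂ x
        + 2 * deriv H x * w₂ x = 0) :
    (∀ f : ℝ → ℝ, ContDiff ℝ (⊤ : ℕ∞) f → ∀ x : ℝ,
        Sop w₁ (Sop w₂ f) x - Sop w₂ (Sop w₁ f) x
          = Sop (fun t => w₁ t * deriv w₂ t - w₂ t * deriv w₁ t) f x) ∧
    (∀ x : ℝ,
        iteratedDeriv 3 (fun t => w₁ t * deriv w₂ t - w₂ t * deriv w₁ t) x
          + 4 * H x * deriv (fun t => w₁ t * deriv w₂ t - w₂ t * deriv w₁ t) x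
          + 2 * deriv H x * (w₁ x * deriv w₂ x - w₂ x * deriv w₁ x) = 0) := by
  have smooth_deriv : ∀ g : ℝ → ℝ, ContDiff ℝ (⊤ : ℕ∞) g → ContDiff ℝ (⊤ : ℕ∞) (deriv g) :=
    fun g hg => (contDiff_infty_iff_deriv.1 hg).2
  have hd : ∀ g : ℝ → ℝ, ContDiff ℝ (⊤ : ℕ∞) g → ∀ x, HasDerivAt g (deriv g x) x :=
    fun g hg x => ((contDiff_infty_iff_deriv.1 hg).1 x).hasDerivAt
  have a0 := hd _ hw₁
  have a1 := hd _ (smooth_deriv _ hw₁)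
  have b0 := hd _ hw₂
  have b1 := hd _ (smooth_deriv _ hw₂)
  have hh := hd _ hH
  have a2 := hd _ (smooth_deriv _ (smooth_deriv _ hw₁))
  have b2 := hd _ (smooth_deriv _ (smooth_deriv _ hw₂))
  simp only [iteratedDeriv_succ, iteratedDeriv_zero] at h₁ h₂ ⊢
  have w1 : deriv (fun t => w₁ t * deriv w₂ t - w₂ t * deriv w₁ t)
      = fun t => w₁ t * deriv (deriv w₂) t - w₂ t * deriv (deriv w₁) t := by
    funext t
    refine ((((a0 t).mul (b1 t)).sub ((b0 t).mul (a1 t))).deriv).trans ?_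
    ring
  have w2 : deriv (fun t => w₁ t * deriv (deriv w₂) t - w₂ t * deriv (deriv w₁) t)
      = fun t => deriv w₁ t * deriv (deriv w₂) t - deriv w₂ t * deriv (deriv w₁) t
        - 4 * (H t * (w₁ t * deriv w₂ t - w₂ t * deriv w₁ t)) := by
    funext t
    refine ((((a0 t).mul (b2 t)).sub ((b0 t).mul (a2 t))).deriv).trans ?_
    linear_combination w₁ t * h₂ t - w₂ t * h₁ t
  constructor
  · intro f hf x
    have f0 := hd _ hf
    have f1 := hd _ (smooth_deriv _ hf)
    have e1 : deriv (Sop w₁ f) x = _ :=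
      ((((a1 x).const_mul (-(1/2))).mul (f0 x)).add ((a0 x).mul (f1 x))).deriv
    have e2 : deriv (Sop w₂ f) x = _ :=
      ((((b1 x).const_mul (-(1/2))).mul (f0 x)).add ((b0 x).mul (f1 x))).deriv
    have u : ∀ w g : ℝ → ℝ, Sop w g x = -(1/2) * deriv w x * g x + w x * deriv g x :=
      fun _ _ => rfl
    rw [u w₁ (Sop w₂ f), u w₂ (Sop w₁ f), e1, e2, u, u, u, w1]
    ring
  · intro x
    rw [w1, w2]
    have e : deriv (fun t => deriv w₁ t * deriv (deriv w₂) t - deriv w₂ t * deriv (deriv w₁) t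
        - 4 * (H t * (w₁ t * deriv w₂ t - w₂ t * deriv w₁ t))) x = _ :=
      ((((a1 x).mul (b2 x)).sub ((b1 x).mul (a2 x))).sub
        (((hh x).mul (((a0 x).mul (b1 x)).sub ((b0 x).mul (a1 x)))).const_mul 4)).deriv
    rw [e]
    simp only [Pi.mul_apply, Pi.sub_apply]
    linear_combination deriv w₁ x * h₂ x - deriv w₂ x * h₁ x
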